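/- Let G be a countable group acting by isometries on a geodesic metric space X with a bordification X̄ = X ∪ ∂X, let (Ω, λ) be a probability space with an ergodic measure-preserving map T : Ω → Ω, and let u : Ω → G be measurable; define the cocycle u(n, ω) := u(ω)u(Tω)⋯u(T^{n−1}ω). Assume the cocycle is integrable, i.e. ∫_Ω d(x, u(1, ω)x) dλ(ω) < ∞ for some x ∈ X; assume that for λ-a.e. ω the sequence (u(n, ω)x) converges to a point ξ(ω) ∈ ∂X and the corresponding backward products converge to a point η(ω) ∈ ∂X; and assume there is a G-equivariant map P : ∂X × ∂X → 𝒫(ΓX) into sets of geodesic lines such that D(η, ξ) := sup_{γ ∈ P(η,ξ)} d(x, γ) is Borel measurable and almost everywhere finite with respect to the joint distribution of (ξ, η). Then there exists A ≥ 0 such that for λ-a.e. ω there exists a geodesic ray γ : [0, ∞) → X with lim_{n→∞} d(u(n, ω)x, γ(An))/n = 0. -/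

import Mathlib

open MeasureTheory Filter Topology
open scoped ENNReal Classical

/-- The cocycle generated by `u` over the transformation `T`:
`u(n, ω) = u(ω) u(Tω) ⋯ u(T^{n−1}ω)`. -/
def cocycle {Ω G : Type*} [Monoid G] (u : Ω → G) (T : Ω → Ω) (n : ℕ) (ω : Ω) : G :=
  ((List.range n).map (fun i => u (T^[i] ω))).prod

/-- The backward products of the cocycle (here `S` is the inverse of `T`):
`b(n, ω) = u(T⁻¹ω)⁻¹ u(T⁻²ω)⁻¹ ⋯ u(T⁻ⁿω)⁻¹`. -/
def backCocycle {Ω G : Type*} [Group G] (u : Ω → G) (S : Ω → Ω) (n : ℕ) (ω : Ω) : G :=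
  ((List.range n).map (fun i => (u (S^[i + 1] ω))⁻¹)).prod

/-- `f` is a geodesic segment from `u` to `v`, parametrized by arclength on
`[0, d(u,v)]`. -/
def IsGeodesicFrom {X : Type*} [MetricSpace X] (f : ℝ → X) (u v : X) : Prop :=
  f 0 = u ∧ f (dist u v) = v ∧
    ∀ s ∈ Set.Icc (0 : ℝ) (dist u v), ∀ t ∈ Set.Icc (0 : ℝ) (dist u v),
      dist (f s) (f t) = |s - t|

/-- `γ` is a geodesic ray, i.e. an isometric embedding of `[0, ∞)`. -/
def IsGeodesicRay {X : Type*} [MetricSpace X] (γ : ℝ → X) : Prop :=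
  ∀ s t : ℝ, 0 ≤ s → 0 ≤ t → dist (γ s) (γ t) = |s - t|

/-- A metric space is geodesic if any two points are joined by a geodesic segment. -/
def GeodesicSpace (X : Type*) [MetricSpace X] : Prop :=
  ∀ u v : X, ∃ f : ℝ → X, IsGeodesicFrom f u v

/-- `D(η, ξ) := sup_{γ ∈ P(η,ξ)} d(x, γ)`, with the convention `D(η, ξ) = ∞`
when `P(η, ξ) = ∅`. -/
noncomputable def pencilSup {X Y : Type*} [MetricSpace X] (x : X)
    (Pen : Y → Y → Set (ℝ → X)) (η ξ : Y) : ℝ≥0∞ :=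
  if Pen η ξ = ∅ then ⊤ else ⨆ γ ∈ Pen η ξ, EMetric.infEdist x (Set.range γ)

section ErgodicAux

variable {Ω : Type*} [MeasurableSpace Ω]

/-- Covering error term. -/
noncomputable def covR (T : Ω → Ω) (ψ χ : Ω → ℝ) (N : ℕ) : ℕ → Ω → ℝ
  | 0, _ => 0
  | n + 1, ω => (if N ≤ n then ψ ω else χ ω) + covR T ψ χ N n (T ω)

lemma covR_nonneg (T : Ω → Ω) {ψ χ : Ω → ℝ} (hψ : ∀ ω, 0 ≤ ψ ω) (hχ : ∀ ω, 0 ≤ χ ω) (N n : ℕ)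
    (ω : Ω) : 0 ≤ covR T ψ χ N n ω := by
  induction n generalizing ω with
  | zero => simp [covR]
  | succ n ih =>
    simp only [covR]
    have := ih (T ω)
    split_ifs
    · linarith [hψ ω]
    · linarith [hχ ω]

lemma covR_shift (T : Ω → Ω) {ψ χ : Ω → ℝ} (hψ : ∀ ω, 0 ≤ ψ ω) (hχ : ∀ ω, 0 ≤ χ ω) (N n k : ℕ)
    (ω : Ω) : covR T ψ χ N n (T^[k] ω) ≤ covR T ψ χ N (n + k) ω := by
  induction k generalizing ω with
  | zero => simp
  | succ k ih =>
    have h := ih (T ω)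
    rw [← Function.iterate_succ_apply] at h
    refine h.trans ?_
    rw [← add_assoc]
    simp only [covR]
    split_ifs
    · linarith [hψ ω]
    · linarith [hχ ω]

lemma covR_small (T : Ω → Ω) {ψ χ : Ω → ℝ} (b : ℕ → Ω → ℝ) (hb0 : ∀ ω, b 0 ω ≤ 0)
    (hb1 : ∀ ω, b 1 ω ≤ χ ω)
    (hsub : ∀ m n ω, b (m + n) ω ≤ b m ω + b n (T^[m] ω))
    (N n : ℕ) (hn : n ≤ N) (ω : Ω) : b n ω ≤ covR T ψ χ N n ω := by
  induction n generalizing ω with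
  | zero => simpa [covR] using hb0 ω
  | succ n ih =>
    have h1 := hsub 1 n ω
    have h2 := ih (by omega) (T ω)
    simp only [covR]
    rw [if_neg (by omega)]
    rw [add_comm n 1]
    simp only [Function.iterate_one] at h1
    linarith [hb1 ω]

lemma covR_bound (T : Ω → Ω) {ψ χ : Ω → ℝ} (b : ℕ → Ω → ℝ) (hb0 : ∀ ω, b 0 ω ≤ 0)
    (hψ : ∀ ω, 0 ≤ ψ ω) (hχ : ∀ ω, 0 ≤ χ ω)
    (hb1 : ∀ ω, b 1 ω ≤ χ ω)
    (hsub : ∀ m n ω, b (m + n) ω ≤ b m ω + b n (T^[m] ω))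
    (N : ℕ) (hgood : ∀ ω, b 1 ω ≤ ψ ω ∨ ∃ k, 1 ≤ k ∧ k ≤ N ∧ b k ω ≤ 0)
    (n : ℕ) (ω : Ω) : b n ω ≤ covR T ψ χ N n ω := by
  induction n using Nat.strong_induction_on generalizing ω with
  | _ n ih =>
    rcases le_or_gt n N with hn | hn
    · exact covR_small T b hb0 hb1 hsub N n hn ω
    · rcases hgood ω with h | ⟨k, hk1, hkN, hk⟩
      · obtain ⟨m, rfl⟩ : ∃ m, n = m + 1 := ⟨n - 1, by omega⟩
        have h1 := hsub 1 m ω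
        have h2 := ih m (by omega) (T ω)
        simp only [covR]
        rw [if_pos (by omega)]
        rw [add_comm m 1]
        simp only [Function.iterate_one] at h1
        linarith
      · obtain ⟨m, rfl⟩ : ∃ m, n = m + k := ⟨n - k, by omega⟩
        have h1 := hsub k m ω
        have h2 := ih m (by omega) (T^[k] ω)
        have h3 := covR_shift T hψ hχ N m k ω
        rw [add_comm k m] at h1
        linarith

lemma covR_integral {μ : Measure Ω} {T : Ω → Ω} (hT : MeasurePreserving T μ μ) {ψ χ : Ω → ℝ}
    (hψi : Integrable ψ μ) (hχi : Integrable χ μ)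
    (hψ : ∀ ω, 0 ≤ ψ ω) (hχ : ∀ ω, 0 ≤ χ ω) (N n : ℕ) :
    Integrable (covR T ψ χ N n) μ ∧
      ∫ ω, covR T ψ χ N n ω ∂μ ≤ n * ∫ ω, ψ ω ∂μ + (min n N : ℕ) * ∫ ω, χ ω ∂μ := by
  have hψ' : 0 ≤ ∫ ω, ψ ω ∂μ := integral_nonneg hψ
  have hχ' : 0 ≤ ∫ ω, χ ω ∂μ := integral_nonneg hχ
  induction n with
  | zero =>
    have : covR T ψ χ N 0 = fun _ => 0 := by funext ω; rfl
    rw [this]; simp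
  | succ n ih =>
    obtain ⟨i1, i2⟩ := ih
    have i3 : Integrable (fun ω => covR T ψ χ N n (T ω)) μ :=
      hT.integrable_comp_of_integrable i1
    have e : ∫ ω, covR T ψ χ N n (T ω) ∂μ = ∫ ω, covR T ψ χ N n ω ∂μ := by
      have h := integral_map (μ := μ) hT.aemeasurable (f := covR T ψ χ N n)
        (by rw [hT.map_eq]; exact i1.aestronglyMeasurable)
      rw [hT.map_eq] at h
      exact h.symm
    by_cases hn : N ≤ n
    · have : covR T ψ χ N (n + 1) = fun ω => ψ ω + covR T ψ χ N n (T ω) := by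
        funext ω; simp [covR, hn]
      rw [this]
      refine ⟨hψi.add i3, ?_⟩
      rw [integral_add hψi i3, e]
      have e1 : min (n + 1) N = N := by omega
      have e2 : min n N = N := by omega
      rw [e1]; rw [e2] at i2
      push_cast
      linarith
    · have : covR T ψ χ N (n + 1) = fun ω => χ ω + covR T ψ χ N n (T ω) := by
        funext ω; simp [covR, hn]
      rw [this]
      refine ⟨hχi.add i3, ?_⟩
      rw [integral_add hχi i3, e]
      have e1 : min (n + 1) N = n + 1 := by omega
      have e2 : min n N = n := by omega
      rw [e1]; rw [e2] at i2
      push_cast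
      linarith

/-- If a.e. some `b n ω ≤ 0`, then the averages of `b n` are eventually small. -/
lemma subadd_cover {μ : Measure Ω} {T : Ω → Ω} (hT : MeasurePreserving T μ μ)
    (b : ℕ → Ω → ℝ) (hb0 : ∀ ω, b 0 ω ≤ 0)
    (hsub : ∀ m n ω, b (m + n) ω ≤ b m ω + b n (T^[m] ω))
    (hm : ∀ n, Measurable (b n)) (hi : ∀ n, Integrable (b n) μ)
    (hgood : ∀ᵐ ω ∂μ, ∃ n, 1 ≤ n ∧ b n ω ≤ 0) (ε : ℝ) (hε : 0 < ε) :
    ∃ n : ℕ, 1 ≤ n ∧ ∫ ω, b n ω ∂μ ≤ ε * n := by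
  let χ : Ω → ℝ := fun ω => max (b 1 ω) 0
  have hχ : ∀ ω, 0 ≤ χ ω := fun ω => le_max_right _ _
  have hχi : Integrable χ μ := (hi 1).pos_part
  let B : ℕ → Set Ω := fun N => {ω | ∀ k, 1 ≤ k → k ≤ N → 0 < b k ω}
  have hB : ∀ N, MeasurableSet (B N) := by
    intro N
    have : B N = ⋂ k, ⋂ (_ : 1 ≤ k), ⋂ (_ : k ≤ N), {ω | 0 < b k ω} := by
      ext ω; simp [B]
    rw [this]
    exact MeasurableSet.iInter fun k => MeasurableSet.iInter fun _ => MeasurableSet.iInter fun _ =>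
      measurableSet_lt measurable_const (hm k)
  let ψ : ℕ → Ω → ℝ := fun N => (B N).indicator χ
  have hψ : ∀ N ω, 0 ≤ ψ N ω := fun N ω => Set.indicator_nonneg (fun ω _ => hχ ω) ω
  have hψi : ∀ N, Integrable (ψ N) μ := fun N => hχi.indicator (hB N)
  have hlim : Tendsto (fun N => ∫ ω, ψ N ω ∂μ) atTop (𝓝 (∫ _, (0 : ℝ) ∂μ)) := by
    refine tendsto_integral_of_dominated_convergence χ (fun N => (hψi N).aestronglyMeasurable)
      hχi (fun N => ae_of_all _ fun ω => ?_) ?_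
    · rw [Real.norm_of_nonneg (hψ N ω)]
      exact Set.indicator_le_self' (fun ω _ => hχ ω) ω
    · filter_upwards [hgood] with ω hω
      obtain ⟨n, hn, hbn⟩ := hω
      refine tendsto_const_nhds.congr' ?_
      filter_upwards [eventually_ge_atTop n] with N hN
      refine (Set.indicator_of_notMem ?_ _).symm
      intro h
      exact absurd (h n hn hN) (not_lt.2 hbn)
  simp only [integral_zero] at hlim
  obtain ⟨N, hN⟩ := (hlim.eventually (gt_mem_nhds (half_pos hε))).exists
  obtain ⟨n, hn⟩ := exists_nat_gt ((N * ∫ ω, χ ω ∂μ) / (ε / 2))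
  refine ⟨n + 1, by omega, ?_⟩
  have key := fun ω => covR_bound T b hb0 (hψ N) hχ (fun ω => le_max_left _ _) hsub N (by
    intro ω
    by_cases h : ω ∈ B N
    · left
      simp only [ψ, Set.indicator_of_mem h]
      exact le_max_left _ _
    · right
      simp only [B, Set.mem_ofPred_eq, not_forall, not_lt] at h
      obtain ⟨k, h1, h2, h3⟩ := h
      exact ⟨k, h1, h2, h3⟩) (n + 1) ω
  obtain ⟨c1, c2⟩ := covR_integral hT (hψi N) hχi (hψ N) hχ N (n + 1)
  have h1 := integral_mono (hi (n + 1)) c1 key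
  have h2 : ((min (n + 1) N : ℕ) : ℝ) * ∫ ω, χ ω ∂μ ≤ N * ∫ ω, χ ω ∂μ := by
    apply mul_le_mul_of_nonneg_right _ (integral_nonneg hχ)
    exact_mod_cast min_le_right _ _
  rw [div_lt_iff₀ (half_pos hε)] at hn
  have h3 : ((n + 1 : ℕ) : ℝ) * ∫ ω, ψ N ω ∂μ ≤ ((n + 1 : ℕ) : ℝ) * (ε / 2) :=
    mul_le_mul_of_nonneg_left hN.le (by positivity)
  push_cast at *
  nlinarith

/-- Lower bound in Kingman's theorem. -/
lemma subadd_lower {μ : Measure Ω} [IsProbabilityMeasure μ] {T : Ω → Ω} (hT : Ergodic T μ)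
    (a : ℕ → Ω → ℝ) (ha0 : ∀ ω, a 0 ω ≤ 0)
    (hsub : ∀ m n ω, a (m + n) ω ≤ a m ω + a n (T^[m] ω))
    (hm : ∀ n, Measurable (a n)) (hi : ∀ n, Integrable (a n) μ)
    (c : ℝ) (hc : ∀ n : ℕ, c * n ≤ ∫ ω, a n ω ∂μ) (c' : ℝ) (hc' : c' < c) :
    ∀ᵐ ω ∂μ, ∀ᶠ n : ℕ in atTop, c' * n ≤ a n ω := by
  obtain ⟨d, hd1, hd2⟩ := exists_between hc'
  let E : Set Ω := ⋃ q : ℚ, ⋃ (_ : (q : ℝ) < d), ⋂ N : ℕ, ⋃ n : ℕ, ⋃ (_ : N ≤ n),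
    {ω | a n ω < q * n}
  have hE : MeasurableSet E := by
    refine MeasurableSet.iUnion fun q => MeasurableSet.iUnion fun _ => MeasurableSet.iInter fun N =>
      MeasurableSet.iUnion fun n => MeasurableSet.iUnion fun _ => ?_
    exact measurableSet_lt (hm n) measurable_const
  have hmem : ∀ ω, ω ∈ E ↔ ∃ q : ℚ, (q : ℝ) < d ∧ ∀ N : ℕ, ∃ n : ℕ, N ≤ n ∧ a n ω < q * n := by
    intro ω; simp [E]
  have hinv : T ⁻¹' E ⊆ E := by
    intro ω hω
    rw [Set.mem_preimage, hmem] at hω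
    obtain ⟨q, hq, hq2⟩ := hω
    obtain ⟨r, hr1, hr2⟩ := exists_rat_btwn hq
    rw [hmem]
    refine ⟨r, hr2, fun N => ?_⟩
    obtain ⟨M, hM⟩ := exists_nat_gt ((a 1 ω - r) / (r - q))
    obtain ⟨n, hn, han⟩ := hq2 (max N M)
    refine ⟨1 + n, by have := le_max_left N M; omega, ?_⟩
    have h1 := hsub 1 n ω
    simp only [Function.iterate_one] at h1
    rw [div_lt_iff₀ (by linarith)] at hM
    have hMn : (M : ℝ) ≤ n := by exact_mod_cast (le_max_right N M).trans hn
    push_cast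
    nlinarith
  rcases hT.ae_empty_or_univ_of_preimage_ae_le hE.nullMeasurableSet
    (LE.le.eventuallyLE hinv) with h | h
  · filter_upwards [h.mem_iff] with ω hω
    have hω' : ω ∉ E := by rw [hω]; simp
    by_contra hcon
    apply hω'
    rw [hmem]
    obtain ⟨q, hq1, hq2⟩ := exists_rat_btwn hd1
    refine ⟨q, hq2, fun N => ?_⟩
    rw [not_eventually] at hcon
    obtain ⟨n, hn, hn2⟩ := (frequently_atTop.1 hcon) N
    refine ⟨n, hn, (not_le.1 hn2).trans_le ?_⟩
    exact mul_le_mul_of_nonneg_right hq1.le (by positivity)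
  · exfalso
    obtain ⟨n, hn, hn2⟩ := subadd_cover hT.toMeasurePreserving (fun n ω => a n ω - d * n)
      (by intro ω; simpa using ha0 ω)
      (by intro m n ω; have := hsub m n ω; push_cast; linarith)
      (fun n => (hm n).sub_const _) (fun n => (hi n).sub (integrable_const _))
      (by
        filter_upwards [h.mem_iff] with ω hω
        have hω' : ω ∈ E := by rw [hω]; simp
        rw [hmem] at hω'
        obtain ⟨q, hq, hq2⟩ := hω'
        obtain ⟨n, hn, hn2⟩ := hq2 1
        refine ⟨n, hn, ?_⟩
        have : (q : ℝ) * n ≤ d * n := mul_le_mul_of_nonneg_right hq.le (by positivity)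
        linarith) ((c - d) / 2) (by linarith)
    rw [integral_sub (hi n) (integrable_const _)] at hn2
    simp at hn2
    have := hc n
    have hn' : (1 : ℝ) ≤ n := by exact_mod_cast hn
    nlinarith

lemma measurable_birkhoffSum' {T : Ω → Ω} (hT : Measurable T) {φ : Ω → ℝ} (hφ : Measurable φ)
    (n : ℕ) : Measurable (birkhoffSum T φ n) := by
  unfold birkhoffSum
  exact Finset.measurable_sum _ fun i _ => hφ.comp (hT.iterate i)

lemma integral_birkhoffSum' {μ : Measure Ω} {T : Ω → Ω} (hT : MeasurePreserving T μ μ)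
    {φ : Ω → ℝ} (hφ : Integrable φ μ) (n : ℕ) :
    Integrable (birkhoffSum T φ n) μ ∧ ∫ ω, birkhoffSum T φ n ω ∂μ = (∫ ω, φ ω ∂μ) * n := by
  have h1 : ∀ i, Integrable (fun ω => φ (T^[i] ω)) μ := fun i =>
    (hT.iterate i).integrable_comp_of_integrable hφ
  refine ⟨?_, ?_⟩
  · unfold birkhoffSum
    exact integrable_finsetSum _ fun i _ => h1 i
  · unfold birkhoffSum
    rw [integral_finsetSum _ fun i _ => h1 i]
    have : ∀ i, ∫ ω, φ (T^[i] ω) ∂μ = ∫ ω, φ ω ∂μ := by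
      intro i
      have h := integral_map (μ := μ) (hT.iterate i).aemeasurable (f := φ)
        (by rw [(hT.iterate i).map_eq]; exact hφ.aestronglyMeasurable)
      rw [(hT.iterate i).map_eq] at h
      exact h.symm
    simp [this, mul_comm]

/-- Squeeze criterion. -/
lemma tendsto_div_of_bounds (s : ℕ → ℝ) (c : ℝ)
    (h1 : ∀ k : ℕ, ∀ᶠ n : ℕ in atTop, (c - 1 / (k + 1)) * n ≤ s n)
    (h2 : ∀ k : ℕ, ∀ᶠ n : ℕ in atTop, s n ≤ (c + 1 / (k + 1)) * n) :
    Tendsto (fun n => s n / n) atTop (𝓝 c) := by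
  rw [Metric.tendsto_atTop']
  intro ε hε
  obtain ⟨k, hk⟩ := exists_nat_one_div_lt hε
  have := (h1 k).and ((h2 k).and (eventually_gt_atTop 0))
  obtain ⟨N, hN⟩ := eventually_atTop.1 this
  refine ⟨N, fun n hn => ?_⟩
  obtain ⟨a1, a2, a3⟩ := hN n hn.le
  have hn' : (0 : ℝ) < n := by exact_mod_cast a3
  rw [Real.dist_eq]
  refine lt_of_le_of_lt ?_ hk
  rw [abs_le]
  constructor
  · have := (le_div_iff₀ hn').2 a1
    linarith
  · have := (div_le_iff₀ hn').2 a2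
    linarith

/-- Birkhoff's theorem, ergodic case. -/
lemma birkhoff_ergodic {μ : Measure Ω} [IsProbabilityMeasure μ] {T : Ω → Ω} (hT : Ergodic T μ)
    {φ : Ω → ℝ} (hφm : Measurable φ) (hφ : Integrable φ μ) :
    ∀ᵐ ω ∂μ, Tendsto (fun n : ℕ => birkhoffSum T φ n ω / n) atTop (𝓝 (∫ ω, φ ω ∂μ)) := by
  have lower : ∀ φ : Ω → ℝ, Measurable φ → Integrable φ μ → ∀ᵐ ω ∂μ, ∀ k : ℕ,
      ∀ᶠ n : ℕ in atTop, ((∫ ω, φ ω ∂μ) - 1 / (k + 1)) * n ≤ birkhoffSum T φ n ω := by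
    intro φ hφm hφ
    rw [ae_all_iff]
    intro k
    refine subadd_lower hT (fun n => birkhoffSum T φ n) (by simp)
      (fun m n ω => (birkhoffSum_add T φ m n ω).le)
      (fun n => measurable_birkhoffSum' hT.measurable hφm n)
      (fun n => (integral_birkhoffSum' hT.toMeasurePreserving hφ n).1) (∫ ω, φ ω ∂μ)
      (fun n => (integral_birkhoffSum' hT.toMeasurePreserving hφ n).2.ge) _ ?_
    have : (0 : ℝ) < 1 / (k + 1) := by positivity
    linarith
  filter_upwards [lower φ hφm hφ, lower (-φ) hφm.neg hφ.neg] with ω h1 h2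
  refine tendsto_div_of_bounds _ _ h1 fun k => ?_
  filter_upwards [h2 k] with n hn
  rw [birkhoffSum_neg] at hn
  simp only [Pi.neg_apply, integral_neg] at hn
  linarith

/-- If `f ∘ T - f` is integrable then `f (T^n ω) / n → 0`. -/
lemma coboundary_sublinear {μ : Measure Ω} [IsProbabilityMeasure μ] {T : Ω → Ω}
    (hT : Ergodic T μ) {f : Ω → ℝ} (hfm : Measurable f)
    (hf : Integrable (fun ω => f (T ω) - f ω) μ) :
    ∀ᵐ ω ∂μ, Tendsto (fun n : ℕ => f (T^[n] ω) / n) atTop (𝓝 0) := by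
  set c := ∫ ω, (f (T ω) - f ω) ∂μ with hc
  have hsum : ∀ n ω, birkhoffSum T (fun ω => f (T ω) - f ω) n ω = f (T^[n] ω) - f ω := by
    intro n ω
    induction n with
    | zero => simp
    | succ n ih => rw [birkhoffSum_succ, ih, Function.iterate_succ_apply']; ring
  have hlim : ∀ᵐ ω ∂μ, Tendsto (fun n : ℕ => f (T^[n] ω) / n) atTop (𝓝 c) := by
    filter_upwards [birkhoff_ergodic hT ((hfm.comp hT.measurable).sub hfm) hf] with ω hω
    have h0 : Tendsto (fun n : ℕ => f ω / n) atTop (𝓝 0) := tendsto_const_div_atTop_nhds_zero_nat _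
    have := hω.add h0
    rw [add_zero] at this
    refine this.congr fun n => ?_
    have h := hsum n ω
    simp only [Pi.sub_apply] at *
    change birkhoffSum T (fun ω => f (T ω) - f ω) n ω / n + f ω / n = _
    rw [h]; ring
  obtain ⟨M, hM⟩ : ∃ M : ℕ, μ {ω | |f ω| ≤ M} ≠ 0 := by
    by_contra hcon
    push Not at hcon
    have : μ (⋃ M : ℕ, {ω | |f ω| ≤ M}) = 0 := measure_iUnion_null hcon
    have huniv : (⋃ M : ℕ, {ω | |f ω| ≤ M}) = Set.univ := by
      ext ω
      simp only [Set.mem_iUnion, Set.mem_ofPred_eq, Set.mem_univ, iff_true]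
      exact exists_nat_ge _
    rw [huniv] at this
    simp at this
  have hms : MeasurableSet {ω | |f ω| ≤ M} :=
    measurableSet_le (by fun_prop) measurable_const
  have hrec := (hT.toMeasurePreserving.conservative).ae_mem_imp_frequently_image_mem
    hms.nullMeasurableSet
  have hfreq := frequently_ae_mem_iff.2 hM
  obtain ⟨ω, h1, h2, h3⟩ := (hfreq.and_eventually (hrec.and hlim)).exists
  have hc0 : c = 0 := by
    by_contra hne
    have habs : Tendsto (fun n : ℕ => |f (T^[n] ω) / n|) atTop (𝓝 |c|) := h3.abs
    have hM0 : Tendsto (fun n : ℕ => (M : ℝ) / n) atTop (𝓝 0) :=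
      tendsto_const_div_atTop_nhds_zero_nat _
    have hlt := hM0.eventually_lt habs (abs_pos.2 hne)
    obtain ⟨n, hn1, hn2⟩ := ((h2 h1).and_eventually hlt).exists
    rw [abs_div, Nat.abs_cast] at hn2
    exact absurd hn2 (not_lt.2 (div_le_div_of_nonneg_right hn1 (by positivity)))
  rw [hc0] at hlim
  exact hlim

/-- Kingman's theorem for the kind of processes we need. -/
lemma kingman_aux {μ : Measure Ω} [IsProbabilityMeasure μ] {T : Ω → Ω} (hT : Ergodic T μ)
    (a : ℕ → Ω → ℝ) (ha0 : ∀ ω, a 0 ω = 0) (hnn : ∀ n ω, 0 ≤ a n ω)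
    (hsub : ∀ m n ω, a (m + n) ω ≤ a m ω + a n (T^[m] ω))
    (hback : ∀ n ω, a n ω ≤ a (n + 1) ω + a 1 (T^[n] ω))
    (hm : ∀ n, Measurable (a n)) (hi1 : Integrable (a 1) μ) :
    ∃ A : ℝ, 0 ≤ A ∧ ∀ᵐ ω ∂μ, Tendsto (fun n : ℕ => a n ω / n) atTop (𝓝 A) := by
  have hle : ∀ n ω, a n ω ≤ birkhoffSum T (a 1) n ω := by
    intro n ω
    induction n with
    | zero => simp [ha0]
    | succ n ih => rw [birkhoffSum_succ]; linarith [hsub n 1 ω]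
  have hi : ∀ n, Integrable (a n) μ := fun n =>
    (integral_birkhoffSum' hT.toMeasurePreserving hi1 n).1.mono' (hm n).aestronglyMeasurable
      (ae_of_all _ fun ω => by rw [Real.norm_of_nonneg (hnn n ω)]; exact hle n ω)
  set A : ℝ := ⨅ n : ℕ, (∫ ω, a (n + 1) ω ∂μ) / (n + 1) with hA
  have hnn' : ∀ n : ℕ, 0 ≤ (∫ ω, a (n + 1) ω ∂μ) / (n + 1) := fun n =>
    div_nonneg (integral_nonneg (hnn _)) (by positivity)
  have hbdd : BddBelow (Set.range fun n : ℕ => (∫ ω, a (n + 1) ω ∂μ) / ((n : ℝ) + 1)) :=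
    ⟨0, by rintro _ ⟨n, rfl⟩; exact hnn' n⟩
  have hA0 : 0 ≤ A := le_ciInf hnn'
  have hAle : ∀ n : ℕ, A * n ≤ ∫ ω, a n ω ∂μ := by
    intro n
    cases n with
    | zero => simp [ha0]
    | succ n =>
      have := ciInf_le hbdd n
      rw [le_div_iff₀ (by positivity)] at this
      push_cast
      exact this
  refine ⟨A, hA0, ?_⟩
  have hlow : ∀ᵐ ω ∂μ, ∀ k : ℕ, ∀ᶠ n : ℕ in atTop, (A - 1 / (k + 1)) * n ≤ a n ω := by
    rw [ae_all_iff]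
    intro k
    refine subadd_lower hT a (fun ω => (ha0 ω).le) hsub hm hi A hAle _ ?_
    have : (0 : ℝ) < 1 / (k + 1) := by positivity
    linarith
  have hup : ∀ᵐ ω ∂μ, ∀ k : ℕ, ∀ᶠ n : ℕ in atTop, a n ω ≤ (A + 1 / (k + 1)) * n := by
    rw [ae_all_iff]
    intro k
    have hk : (0 : ℝ) < 1 / (k + 1) := by positivity
    obtain ⟨m', hm'⟩ := exists_lt_of_ciInf_lt (show A < A + 1 / (k + 1) by linarith)
    set m := m' + 1 with hmdef
    have hmpos : (0 : ℝ) < m := by positivity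
    have hint : (∫ ω, a m ω ∂μ) < (A + 1 / (k + 1)) * m := by
      rw [div_lt_iff₀ (by positivity)] at hm'
      push_cast [hmdef]
      exact hm'
    have hSm := (integral_birkhoffSum' hT.toMeasurePreserving hi1 m).1
    have hSmm := measurable_birkhoffSum' hT.measurable (hm 1) m
    have hco := coboundary_sublinear hT hSmm
      ((hT.toMeasurePreserving.integrable_comp_of_integrable hSm).sub hSm)
    filter_upwards [birkhoff_ergodic hT (hm m) (hi m), hco] with ω h1 h2
    have hW : ∀ n, ∑ j ∈ Finset.range m, a (n + j) ω ≤
        ∑ j ∈ Finset.range m, a j ω + birkhoffSum T (a m) n ω := by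
      intro n
      induction n with
      | zero => simp
      | succ n ih =>
        have e := Finset.sum_range_succ (fun j => a (n + j) ω) m
        rw [Finset.sum_range_succ'] at e
        have e2 : ∑ j ∈ Finset.range m, a (n + 1 + j) ω =
            ∑ j ∈ Finset.range m, a (n + (j + 1)) ω := by
          refine Finset.sum_congr rfl fun j _ => ?_
          congr 1; omega
        rw [e2, birkhoffSum_succ]
        have := hsub n m ω
        simp only [add_zero] at e
        linarith
    have hb : ∀ n j, a n ω ≤ a (n + j) ω + birkhoffSum T (a 1) j (T^[n] ω) := by
      intro n j
      induction j with
      | zero => simp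
      | succ j ih =>
        rw [birkhoffSum_succ, ← Function.iterate_add_apply, add_comm j n]
        have := hback (n + j) ω
        have e3 : n + (j + 1) = n + j + 1 := by omega
        rw [e3]
        linarith
    have hmono : ∀ ω' j, j ≤ m → birkhoffSum T (a 1) j ω' ≤ birkhoffSum T (a 1) m ω' := by
      intro ω' j hj
      unfold birkhoffSum
      exact Finset.sum_le_sum_of_subset_of_nonneg (by simpa using hj) fun i _ _ => hnn _ _
    have hfin : ∀ n : ℕ, m * a n ω ≤ (∑ j ∈ Finset.range m, a j ω + birkhoffSum T (a m) n ω)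
        + m * birkhoffSum T (a 1) m (T^[n] ω) := by
      intro n
      have h : ∑ j ∈ Finset.range m, a n ω ≤
          ∑ j ∈ Finset.range m, (a (n + j) ω + birkhoffSum T (a 1) m (T^[n] ω)) :=
        Finset.sum_le_sum fun j hj => (hb n j).trans (by
          have := hmono (T^[n] ω) j (Finset.mem_range.1 hj).le
          linarith)
      rw [Finset.sum_add_distrib] at h
      simp only [Finset.sum_const, Finset.card_range, nsmul_eq_mul] at h
      linarith [hW n]
    have hl : Tendsto (fun n : ℕ => (∑ j ∈ Finset.range m, a j ω) / n
        + birkhoffSum T (a m) n ω / n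
        + m * (birkhoffSum T (a 1) m (T^[n] ω) / n)) atTop
        (𝓝 (0 + (∫ ω, a m ω ∂μ) + m * 0)) :=
      ((tendsto_const_div_atTop_nhds_zero_nat _).add h1).add (h2.const_mul _)
    rw [zero_add, mul_zero, add_zero] at hl
    filter_upwards [hl.eventually (gt_mem_nhds hint), eventually_gt_atTop 0] with n hn hn0
    have hn0' : (0 : ℝ) < n := by exact_mod_cast hn0
    have h5 := hfin n
    have h6 : ((∑ j ∈ Finset.range m, a j ω + birkhoffSum T (a m) n ω)
        + m * birkhoffSum T (a 1) m (T^[n] ω)) / n < (A + 1 / (k + 1)) * m := by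
      refine lt_of_eq_of_lt ?_ hn
      ring
    rw [div_lt_iff₀ hn0'] at h6
    have h7 : m * a n ω ≤ m * ((A + 1 / (k + 1)) * n) := by linarith
    exact le_of_mul_le_mul_left h7 hmpos
  filter_upwards [hlow, hup] with ω h1 h2
  exact tendsto_div_of_bounds _ _ h1 h2

end ErgodicAux

/-- Deterministic part: sublinear tracking of a ray. -/
lemma exists_ray_of_tracking {X : Type*} [MetricSpace X] (p : ℕ → X) (γ : ℝ → X)
    (hγ : Isometry γ) (t r : ℕ → ℝ) (A : ℝ) (hA : 0 ≤ A)
    (hr : ∀ n, dist (p n) (γ (t n)) ≤ r n)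
    (hr0 : Tendsto (fun n : ℕ => r n / n) atTop (𝓝 0))
    (hp : Tendsto (fun n : ℕ => dist (p 0) (p n) / n) atTop (𝓝 A))
    (hstep : Tendsto (fun n : ℕ => dist (p n) (p (n + 1)) / n) atTop (𝓝 0)) :
    ∃ γ' : ℝ → X, IsGeodesicRay γ' ∧
      Tendsto (fun n : ℕ => dist (p n) (γ' (A * n)) / n) atTop (𝓝 0) := by
  have hd : ∀ s s', dist (γ s) (γ s') = |s - s'| := fun s s' => by
    rw [hγ.dist_eq, Real.dist_eq]
  -- `|t n| / n → A`
  have htA : Tendsto (fun n : ℕ => |t n| / n) atTop (𝓝 A) := by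
    have hdiff : ∀ n, |(|t n| - dist (p 0) (p n))| ≤ r n + (r 0 + |t 0|) := by
      intro n
      have h1 := hr n
      have h2 := hr 0
      have h3 := hd (t 0) (t n)
      have h4 := dist_triangle4 (γ (t 0)) (p 0) (p n) (γ (t n))
      have h5 := dist_triangle4 (p 0) (γ (t 0)) (γ (t n)) (p n)
      rw [dist_comm (γ (t 0)) (p 0)] at h4
      rw [dist_comm (γ (t n)) (p n)] at h5
      have h6 := abs_sub_abs_le_abs_sub (t n) (t 0)
      have h7 := abs_sub (t 0) (t n)
      rw [abs_sub_comm (t n) (t 0)] at h6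
      rw [abs_le]
      constructor <;> linarith
    have hz : Tendsto (fun n : ℕ => r n / n + (r 0 + |t 0|) / n) atTop (𝓝 (0 + 0)) :=
      hr0.add (tendsto_const_div_atTop_nhds_zero_nat _)
    rw [add_zero] at hz
    have hz2 : Tendsto (fun n : ℕ => (|t n| - dist (p 0) (p n)) / n) atTop (𝓝 0) := by
      refine squeeze_zero_norm (fun n => ?_) hz
      rw [Real.norm_eq_abs, abs_div, Nat.abs_cast, ← add_div]
      exact div_le_div_of_nonneg_right (hdiff n) (by positivity)
    have := hz2.add hp
    rw [zero_add] at this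
    refine this.congr fun n => ?_
    ring
  -- reduce to choosing a sign
  suffices h : ∃ σ : ℝ, (σ = 1 ∨ σ = -1) ∧
      Tendsto (fun n : ℕ => |t n - σ * (A * n)| / n) atTop (𝓝 0) by
    obtain ⟨σ, hσ, hlim⟩ := h
    refine ⟨fun s => γ (σ * s), ?_, ?_⟩
    · intro s s' _ _
      rw [hd, ← mul_sub, abs_mul]
      rcases hσ with rfl | rfl <;> simp
    · have hz := hr0.add hlim
      rw [add_zero] at hz
      refine squeeze_zero (fun n => by positivity) (fun n => ?_) hz
      rw [← add_div]
      refine div_le_div_of_nonneg_right ?_ (by positivity)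
      have := dist_triangle (p n) (γ (t n)) (γ (σ * (A * n)))
      rw [hd] at this
      linarith [hr n]
  -- enough: eventually constant sign
  have hsign : ∀ σ : ℝ, (σ = 1 ∨ σ = -1) → (∀ᶠ n in atTop, t n = σ * |t n|) →
      Tendsto (fun n : ℕ => |t n - σ * (A * n)| / n) atTop (𝓝 0) := by
    intro σ hσ hev
    have h1 : Tendsto (fun n : ℕ => |(|t n| / n - A)|) atTop (𝓝 |A - A|) :=
      (htA.sub_const A).abs
    rw [sub_self, abs_zero] at h1
    refine h1.congr' ?_
    filter_upwards [hev, eventually_gt_atTop 0] with n hn hn0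
    have hn' : (0 : ℝ) < n := by exact_mod_cast hn0
    have e : t n - σ * (A * n) = σ * (|t n| - A * n) := by
      rw [mul_sub, ← hn]
    have hσ1 : |σ| = 1 := by rcases hσ with rfl | rfl <;> simp
    rw [e, abs_mul, hσ1, one_mul]
    have e2 : |t n| / n - A = (|t n| - A * n) / n := by field_simp
    rw [e2, abs_div, Nat.abs_cast]
  rcases hA.eq_or_lt with hA0 | hApos
  · subst hA0
    refine ⟨1, Or.inl rfl, ?_⟩
    simpa using htA
  · have e1 : ∀ᶠ n : ℕ in atTop, A / 2 * n < |t n| := by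
      filter_upwards [htA.eventually (lt_mem_nhds (half_lt_self hApos)), eventually_gt_atTop 0]
        with n hn hn0
      exact (lt_div_iff₀ (by exact_mod_cast hn0)).1 hn
    have e2 : ∀ᶠ n : ℕ in atTop, r n < A / 16 * n := by
      filter_upwards [hr0.eventually (gt_mem_nhds (show 0 < A / 16 by linarith)),
        eventually_gt_atTop 0] with n hn hn0
      exact (div_lt_iff₀ (by exact_mod_cast hn0)).1 hn
    have e3 : ∀ᶠ n : ℕ in atTop, dist (p n) (p (n + 1)) < A / 16 * n := by
      filter_upwards [hstep.eventually (gt_mem_nhds (show 0 < A / 16 by linarith)),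
        eventually_gt_atTop 0] with n hn hn0
      exact (div_lt_iff₀ (by exact_mod_cast hn0)).1 hn
    obtain ⟨N, hN⟩ := eventually_atTop.1 (e1.and (e2.and (e3.and (eventually_ge_atTop 1))))
    have hst : ∀ n, N ≤ n → |t (n + 1) - t n| ≤ A / 4 * n := by
      intro n hn
      obtain ⟨_, b2, b3, b4⟩ := hN n hn
      obtain ⟨_, c2, _⟩ := hN (n + 1) (by omega)
      have h4 := dist_triangle4 (γ (t (n + 1))) (p (n + 1)) (p n) (γ (t n))
      rw [hd, dist_comm (γ (t (n + 1))), dist_comm (p (n + 1)) (p n)] at h4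
      have h1 := hr n
      have h2 := hr (n + 1)
      push_cast at c2
      have : (1 : ℝ) ≤ n := by exact_mod_cast b4
      nlinarith
    have hpos : ∀ n, N ≤ n → (0 : ℝ) < A / 4 * n ∧ A / 2 * n < |t n| := by
      intro n hn
      obtain ⟨b1, _, _, b4⟩ := hN n hn
      have : (1 : ℝ) ≤ n := by exact_mod_cast b4
      exact ⟨by positivity, b1⟩
    rcases le_or_gt 0 (t N) with h0 | h0
    · refine ⟨1, Or.inl rfl, hsign 1 (Or.inl rfl) ?_⟩
      filter_upwards [eventually_ge_atTop N] with n hn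
      have : 0 ≤ t n := by
        induction n, hn using Nat.le_induction with
        | base => exact h0
        | succ n hn ih =>
          have h1 := hst n hn
          have h2 := hpos n hn
          rw [abs_of_nonneg ih] at h2
          rw [abs_le] at h1
          linarith [h1.1, h2.1, h2.2]
      rw [abs_of_nonneg this, one_mul]
    · refine ⟨-1, Or.inr rfl, hsign (-1) (Or.inr rfl) ?_⟩
      filter_upwards [eventually_ge_atTop N] with n hn
      have : t n < 0 := by
        induction n, hn using Nat.le_induction with
        | base => exact h0
        | succ n hn ih =>
          have h1 := hst n hn
          have h2 := hpos n hn
          rw [abs_of_neg ih] at h2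
          rw [abs_le] at h1
          linarith [h1.2, h2.1, h2.2]
      rw [abs_of_neg this]; ring

lemma cocycle_succ' {Ω G : Type*} [Monoid G] (u : Ω → G) (T : Ω → Ω) (n : ℕ) (ω : Ω) :
    cocycle u T (n + 1) ω = cocycle u T n ω * u (T^[n] ω) := by
  simp [cocycle, List.range_succ]

lemma cocycle_add' {Ω G : Type*} [Monoid G] (u : Ω → G) (T : Ω → Ω) (m n : ℕ) (ω : Ω) :
    cocycle u T (m + n) ω = cocycle u T m ω * cocycle u T n (T^[m] ω) := by
  induction n with
  | zero => simp [cocycle]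
  | succ n ih =>
    rw [← add_assoc, cocycle_succ', ih, cocycle_succ', mul_assoc, ← Function.iterate_add_apply,
      add_comm n m]

lemma cocycle_one' {Ω G : Type*} [Monoid G] (u : Ω → G) (T : Ω → Ω) (ω : Ω) :
    cocycle u T 1 ω = u ω := by
  simp [cocycle]

lemma backCocycle_succ' {Ω G : Type*} [Group G] (u : Ω → G) (T S : Ω → Ω)
    (hST : ∀ ω, S (T ω) = ω) (n : ℕ) (ω : Ω) :
    backCocycle u S (n + 1) (T ω) = (u ω)⁻¹ * backCocycle u S n ω := by
  simp [backCocycle, List.range_succ_eq_map, Function.comp_def, hST]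

lemma pencilSup_le_add {X Y : Type*} [MetricSpace X] (x y : X)
    (Pen : Y → Y → Set (ℝ → X)) (a b : Y) :
    pencilSup y Pen a b ≤ pencilSup x Pen a b + edist y x := by
  unfold pencilSup
  split_ifs with h
  · simp
  · refine iSup₂_le fun γ hγ => ?_
    refine (Metric.infEDist_le_infEDist_add_edist (y := x)).trans ?_
    gcongr
    exact le_iSup₂ (f := fun γ (_ : γ ∈ Pen a b) => Metric.infEDist x (Set.range γ)) γ hγ

lemma pencilSup_smul {G X Y : Type*} [Group G] [MetricSpace X] [MulAction G X] [MulAction G Y]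
    (hiso : ∀ g : G, Isometry (fun x : X => g • x)) (x : X)
    (Pen : Y → Y → Set (ℝ → X)) (g : G) (a b : Y)
    (h : Pen (g⁻¹ • a) (g⁻¹ • b) = (fun γ : ℝ → X => (fun t => g⁻¹ • γ t)) '' Pen a b) :
    pencilSup x Pen (g⁻¹ • a) (g⁻¹ • b) = pencilSup (g • x) Pen a b := by
  unfold pencilSup
  rw [h]
  simp only [Set.image_eq_empty]
  split_ifs with h0
  · rfl
  · rw [iSup_image]
    refine iSup_congr fun γ => iSup_congr fun _ => ?_
    change Metric.infEDist x _ = Metric.infEDist (g • x) _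
    rw [← Metric.infEDist_image (hiso g)]
    congr 1
    rw [← Set.range_comp]
    congr 1
    funext t
    simp

/-- **Sublinear tracking for integrable ergodic cocycles.**
Let `G` be a countable group acting by isometries on a geodesic metric space `X` with a
bordification `X̄` (`ι : X → Y` an open dense embedding, the `G`-action extending to `Y`
by homeomorphisms).  Let `T` be an invertible ergodic measure-preserving transformation
of a probability space `(Ω, λ)` and `u : Ω → G` measurable, and form the cocycle
`u(n,ω) = u(ω)u(Tω)⋯u(T^{n−1}ω)`.  Assume the cocycle is integrable, that a.e. the
forward orbit `u(n,ω)x` and the backward products converge to boundary points `ξ(ω)`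
and `η(ω)`, and that there is a `G`-equivariant assignment `P` of sets of geodesic lines
to pairs of boundary points whose distance function `D` is Borel measurable and a.e.
finite for the joint law of `(ξ, η)`.  Then there is `A ≥ 0` such that a.e. the orbit
`u(n,ω)x` tracks some geodesic ray sublinearly. -/
theorem stmt_16 {G X Y Ω : Type*} [Group G] [Countable G]
    [MeasurableSpace G] [MeasurableSingletonClass G]
    [MetricSpace X] [MulAction G X]
    (hiso : ∀ g : G, Isometry (fun x : X => g • x))
    (hgeo : GeodesicSpace X)
    -- the bordification
    [TopologicalSpace Y] [T2Space Y] [SecondCountableTopology Y]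
    [MeasurableSpace Y] [BorelSpace Y]
    (ι : X → Y) (hemb : IsOpenEmbedding ι) (hdense : DenseRange ι)
    [MulAction G Y] (hcont : ∀ g : G, Continuous (fun y : Y => g • y))
    (hcompat : ∀ (g : G) (z : X), ι (g • z) = g • ι z)
    -- the ergodic system and the cocycle
    [MeasurableSpace Ω] (lam : Measure Ω) [IsProbabilityMeasure lam]
    (T : Ω → Ω) (hT : Ergodic T lam)
    (S : Ω → Ω) (hST : ∀ ω, S (T ω) = ω) (hTS : ∀ ω, T (S ω) = ω)
    (u : Ω → G) (hu : Measurable u)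
    (x : X) (hint : Integrable (fun ω => dist x (u ω • x)) lam)
    -- almost sure convergence to the boundary, with measurable limit maps
    (ξ η : Ω → Y) (hξ_meas : Measurable ξ) (hη_meas : Measurable η)
    (hconv : ∀ᵐ ω ∂lam, ξ ω ∉ Set.range ι ∧
      Tendsto (fun n : ℕ => ι (cocycle u T n ω • x)) atTop (𝓝 (ξ ω)))
    (hconv' : ∀ᵐ ω ∂lam, η ω ∉ Set.range ι ∧
      Tendsto (fun n : ℕ => ι (backCocycle u S n ω • x)) atTop (𝓝 (η ω)))
    -- the equivariant family of geodesic lines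
    (Pen : Y → Y → Set (ℝ → X))
    (hPgeod : ∀ η' ξ' : Y, ∀ γ ∈ Pen η' ξ', Isometry γ)
    (hPequiv : ∀ (g : G) (η' ξ' : Y), η' ∉ Set.range ι → ξ' ∉ Set.range ι →
      Pen (g • η') (g • ξ') = (fun γ : ℝ → X => (fun t => g • γ t)) '' Pen η' ξ')
    (hDmeas : Measurable (fun p : {y : Y // y ∉ Set.range ι} × {y : Y // y ∉ Set.range ι} =>
      pencilSup x Pen p.1.1 p.2.1))
    (hDfin : ∀ᵐ p ∂(lam.map (fun ω => (ξ ω, η ω))), pencilSup x Pen p.1 p.2 < ⊤) :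
    ∃ A : ℝ, 0 ≤ A ∧ ∀ᵐ ω ∂lam, ∃ γ : ℝ → X, IsGeodesicRay γ ∧
      Tendsto (fun n : ℕ => dist (cocycle u T n ω • x) (γ (A * n)) / n) atTop (𝓝 0) := by
  have hcoc_meas : ∀ n, Measurable (cocycle u T n) := by
    intro n
    induction n with
    | zero =>
      have : cocycle u T 0 = fun _ => 1 := by funext ω; simp [cocycle]
      rw [this]; exact measurable_const
    | succ n ih =>
      have : cocycle u T (n + 1) = fun ω => (fun q : G × G => q.1 * q.2)
          (cocycle u T n ω, u (T^[n] ω)) := by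
        funext ω; exact cocycle_succ' u T n ω
      rw [this]
      exact (measurable_of_countable (fun q : G × G => q.1 * q.2)).comp
        (ih.prodMk (hu.comp (hT.measurable.iterate n)))
  set a : ℕ → Ω → ℝ := fun n ω => dist x (cocycle u T n ω • x) with ha
  have ha1 : a 1 = fun ω => dist x (u ω • x) := by
    funext ω; simp only [ha, cocycle_one']
  have ham : ∀ n, Measurable (a n) := fun n =>
    (measurable_of_countable (fun g : G => dist x (g • x))).comp (hcoc_meas n)
  have hai : Integrable (a 1) lam := by rw [ha1]; exact hint
  have hdist : ∀ (g : G) (y z : X), dist (g • y) (g • z) = dist y z := fun g y z =>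
    (hiso g).dist_eq y z
  have hstepeq : ∀ n ω, dist (cocycle u T n ω • x) (cocycle u T (n + 1) ω • x)
      = a 1 (T^[n] ω) := by
    intro n ω
    rw [cocycle_succ', mul_smul, hdist, ha1]
  obtain ⟨A, hA, hking⟩ := kingman_aux hT a (by intro ω; simp [ha, cocycle])
    (fun n ω => dist_nonneg)
    (by
      intro m n ω
      simp only [ha]
      rw [cocycle_add', mul_smul]
      refine (dist_triangle _ (cocycle u T m ω • x) _).trans ?_
      rw [hdist])
    (by
      intro n ω
      rw [← hstepeq n ω]
      simp only [ha]
      rw [dist_comm (cocycle u T n ω • x)]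
      exact dist_triangle _ _ _) ham hai
  refine ⟨A, hA, ?_⟩
  have hDfin' : ∀ᵐ ω ∂lam, pencilSup x Pen (ξ ω) (η ω) < ⊤ :=
    ae_of_ae_map (hξ_meas.prodMk hη_meas).aemeasurable hDfin
  have hgood : ∀ᵐ ω ∂lam, ∀ n : ℕ, ((ξ (T^[n] ω) ∉ Set.range ι ∧
      Tendsto (fun k : ℕ => ι (cocycle u T k (T^[n] ω) • x)) atTop (𝓝 (ξ (T^[n] ω)))) ∧
      (η (T^[n] ω) ∉ Set.range ι ∧
      Tendsto (fun k : ℕ => ι (backCocycle u S k (T^[n] ω) • x)) atTop (𝓝 (η (T^[n] ω))))) ∧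
      pencilSup x Pen (ξ (T^[n] ω)) (η (T^[n] ω)) < ⊤ := by
    rw [ae_all_iff]
    intro n
    exact (hT.quasiMeasurePreserving.iterate n).ae ((hconv.and hconv').and hDfin')
  -- equivariance of the boundary maps
  have hequiv : ∀ᵐ ω ∂lam, ∀ n : ℕ, ξ (T^[n] ω) = (cocycle u T n ω)⁻¹ • ξ ω ∧
      η (T^[n] ω) = (cocycle u T n ω)⁻¹ • η ω := by
    filter_upwards [hgood] with ω hω n
    induction n with
    | zero => simp [cocycle]
    | succ n ih =>
      obtain ⟨⟨⟨_, g1⟩, ⟨_, g2⟩⟩, _⟩ := hω n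
      obtain ⟨⟨⟨_, g1'⟩, ⟨_, g2'⟩⟩, _⟩ := hω (n + 1)
      set ω' := T^[n] ω with hω'
      have hs : T^[n + 1] ω = T ω' := Function.iterate_succ_apply' T n ω
      rw [hs] at g1' g2' ⊢
      have k1 : ξ (T ω') = (u ω')⁻¹ • ξ ω' := by
        have l1 := ((hcont (u ω')⁻¹).tendsto (ξ ω')).comp ((tendsto_add_atTop_iff_nat 1).2 g1)
        refine tendsto_nhds_unique g1' (l1.congr fun k => ?_)
        simp only [Function.comp_apply]
        rw [← hcompat, add_comm k 1, cocycle_add', cocycle_one', Function.iterate_one,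
          ← mul_smul, inv_mul_cancel_left]
      have k2 : η (T ω') = (u ω')⁻¹ • η ω' := by
        have l1 := ((hcont (u ω')⁻¹).tendsto (η ω')).comp g2
        have l2 := (tendsto_add_atTop_iff_nat 1).2 g2'
        refine tendsto_nhds_unique l2 (l1.congr fun k => ?_)
        simp only [Function.comp_apply]
        rw [← hcompat, backCocycle_succ' u T S hST, ← mul_smul]
      rw [k1, k2, ih.1, ih.2, cocycle_succ', mul_inv_rev, mul_smul, mul_smul]
      exact ⟨rfl, rfl⟩
  have hDeq : ∀ᵐ ω ∂lam, ∀ n : ℕ, pencilSup x Pen (ξ (T^[n] ω)) (η (T^[n] ω)) =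
      pencilSup (cocycle u T n ω • x) Pen (ξ ω) (η ω) := by
    filter_upwards [hgood, hequiv] with ω h1 h2 n
    rw [(h2 n).1, (h2 n).2]
    exact pencilSup_smul hiso x Pen _ _ _ (hPequiv _ _ _ (h1 0).1.1.1 (h1 0).1.2.1)
  -- a measurable version of the distance function
  obtain ⟨D', hD'm, hD'⟩ : ∃ D' : Y × Y → ℝ≥0∞, Measurable D' ∧
      ∀ p : Y × Y, p.1 ∉ Set.range ι → p.2 ∉ Set.range ι → D' p = pencilSup x Pen p.1 p.2 := by
    have hms : MeasurableSet {y : Y | y ∉ Set.range ι} :=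
      hemb.isOpen_range.measurableSet.compl
    have hme := MeasurableEmbedding.subtype_coe hms
    obtain ⟨D', h1, h2⟩ := (hme.prodMap hme).exists_measurable_extend hDmeas
      (fun _ => ⟨0⟩)
    refine ⟨D', h1, fun p hp1 hp2 => ?_⟩
    exact congrFun h2 (⟨p.1, hp1⟩, ⟨p.2, hp2⟩)
  set f : Ω → ℝ := fun ω => (D' (ξ ω, η ω)).toReal with hf
  have hfm : Measurable f := (hD'm.comp (hξ_meas.prodMk hη_meas)).ennreal_toReal
  have hfeq : ∀ᵐ ω ∂lam, ∀ n : ℕ, ENNReal.ofReal (f (T^[n] ω)) =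
      pencilSup (cocycle u T n ω • x) Pen (ξ ω) (η ω) := by
    filter_upwards [hgood, hDeq] with ω h1 h2 n
    rw [← h2 n]
    simp only [hf]
    rw [hD' _ (h1 n).1.1.1 (h1 n).1.2.1, ENNReal.ofReal_toReal (h1 n).2.ne]
  have hfi : Integrable (fun ω => f (T ω) - f ω) lam := by
    refine hai.mono' ((hfm.comp hT.measurable).sub hfm).aestronglyMeasurable ?_
    filter_upwards [hfeq] with ω hω
    have e0 := hω 0
    have e1 := hω 1
    have hn0 : 0 ≤ f ω := ENNReal.toReal_nonneg
    have hn1 : 0 ≤ f (T ω) := ENNReal.toReal_nonneg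
    have ez : cocycle u T 0 ω • x = x := by simp [cocycle]
    rw [ez] at e0
    simp only [Function.iterate_zero, id_eq, Function.iterate_one] at e0 e1
    have i1 := pencilSup_le_add x (cocycle u T 1 ω • x) Pen (ξ ω) (η ω)
    have i2 := pencilSup_le_add (cocycle u T 1 ω • x) x Pen (ξ ω) (η ω)
    rw [← e0, ← e1, edist_dist, ← ENNReal.ofReal_add (by assumption) dist_nonneg,
      ENNReal.ofReal_le_ofReal_iff (by positivity)] at i1 i2
    rw [dist_comm] at i1
    change |f (T ω) - f ω| ≤ dist x (cocycle u T 1 ω • x)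
    rw [abs_le]
    constructor <;> linarith
  have hsub := coboundary_sublinear hT hfm hfi
  have hsub2 := coboundary_sublinear hT (ham 1)
    ((hT.toMeasurePreserving.integrable_comp_of_integrable hai).sub hai)
  filter_upwards [hking, hgood, hfeq, hsub, hsub2] with ω h1 h2 h3 h4 h5
  have hlt := (h2 0).2
  simp only [Function.iterate_zero, id_eq] at hlt
  have hne : Pen (ξ ω) (η ω) ≠ ∅ := by
    intro he
    simp [pencilSup, he] at hlt
  obtain ⟨γ, hγ⟩ := Set.nonempty_iff_ne_empty.2 hne
  have ht : ∀ n : ℕ, ∃ t : ℝ, dist (cocycle u T n ω • x) (γ t) ≤ f (T^[n] ω) + 1 := by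
    intro n
    have hfn : 0 ≤ f (T^[n] ω) := ENNReal.toReal_nonneg
    have hle : Metric.infEDist (cocycle u T n ω • x) (Set.range γ) ≤
        ENNReal.ofReal (f (T^[n] ω)) := by
      rw [h3 n, pencilSup, if_neg hne]
      exact le_iSup₂ (f := fun γ (_ : γ ∈ Pen (ξ ω) (η ω)) =>
        Metric.infEDist (cocycle u T n ω • x) (Set.range γ)) γ hγ
    have hlt2 : Metric.infEDist (cocycle u T n ω • x) (Set.range γ) <
        ENNReal.ofReal (f (T^[n] ω) + 1) :=
      hle.trans_lt ((ENNReal.ofReal_lt_ofReal_iff (by linarith)).2 (by linarith))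
    obtain ⟨_, ⟨t, rfl⟩, ht⟩ := Metric.infEDist_lt_iff.1 hlt2
    refine ⟨t, ?_⟩
    rw [edist_dist, ENNReal.ofReal_lt_ofReal_iff (by linarith)] at ht
    exact ht.le
  choose t ht using ht
  refine exists_ray_of_tracking (fun n => cocycle u T n ω • x) γ (hPgeod _ _ γ hγ) t
    (fun n => f (T^[n] ω) + 1) A hA ht ?_ ?_ ?_
  · have := h4.add (tendsto_const_div_atTop_nhds_zero_nat (1 : ℝ))
    rw [add_zero] at this
    exact this.congr fun n => (add_div _ _ _).symm
  · refine h1.congr fun n => ?_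
    simp [ha, cocycle]
  · refine h5.congr fun n => ?_
    rw [hstepeq]
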